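/- For every fixed positive integer p, the total number m_n^{(p)} of p-watermelons of length 2n satisfies m_n^{(p)} = (2/n)^{C(p,2)} · C(2n,n)^p · ( Π_{i=0}^{p−1} i! ) · (1 + O(n^{−1})) as n → ∞, where C(p,2) = p(p−1)/2 and C(2n,n) is the central binomial coefficient. -/

import Mathlib

open scoped BigOperators
open Filter Asymptotics

/-- Binomial coefficient with integer lower argument, `0` outside range. -/
def ichoose (a : ℕ) (b : ℤ) : ℕ := if 0 ≤ b then a.choose b.toNat else 0

/-- A `p`-watermelon of length `2n` (no wall): the `i`-th branch starts at `(0,2i)`,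
ends at `(2n,2i)`, takes steps `(1,1)` or `(1,-1)`, and no two branches share a point.
`y i t` is the ordinate of the `i`-th branch at abscissa `t`. -/
def IsMelon (p n : ℕ) (y : Fin p → Fin (2*n+1) → ℤ) : Prop :=
  (∀ i, y i 0 = 2 * (i : ℤ)) ∧
  (∀ i, y i (Fin.last (2*n)) = 2 * (i : ℤ)) ∧
  (∀ i (t : Fin (2*n)), y i t.succ - y i t.castSucc = 1 ∨ y i t.succ - y i t.castSucc = -1) ∧
  (∀ i j, i ≠ j → ∀ t, y i t ≠ y j t)

/-- The height of a watermelon: the maximal ordinate reached (by its top-most branch). -/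
noncomputable def melonHeight {p n : ℕ} (y : Fin p → Fin (2*n+1) → ℤ) : ℤ :=
  sSup {v | ∃ i t, y i t = v}

/-- The depth of a watermelon: the minimal ordinate reached (by its bottom-most branch). -/
noncomputable def melonDepth {p n : ℕ} (y : Fin p → Fin (2*n+1) → ℤ) : ℤ :=
  sInf {v | ∃ i t, y i t = v}

/-- The range of a watermelon: height minus depth. -/
noncomputable def melonRange {p n : ℕ} (y : Fin p → Fin (2*n+1) → ℤ) : ℤ :=
  melonHeight y - melonDepth y


def WS (p t : ℕ) (k : Fin p → ℤ) (z : Fin (t+1) → Fin p → ℤ) : Prop :=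
  (∀ i, z 0 i = (i : ℤ)) ∧ z (Fin.last t) = k ∧
  (∀ (s : Fin t) i, z s.succ i = z s.castSucc i ∨ z s.succ i = z s.castSucc i + 1) ∧
  (∀ s, Function.Injective (z s))

/-- subtract indicator -/
def subInd {p : ℕ} (k : Fin p → ℤ) (s : Finset (Fin p)) : Fin p → ℤ :=
  fun i => if i ∈ s then k i else k i - 1

lemma subInd_inj {p : ℕ} (k : Fin p → ℤ) (s s' : Finset (Fin p)) (h : subInd k s = subInd k s') :
    s = s' := by
  ext i
  have := congrFun h i
  simp only [subInd] at this
  split_ifs at this <;> simp_all <;> omega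

def stepMap (p t : ℕ) (k : Fin p → ℤ) (hk : Function.Injective k) :
    (Σ s : Finset (Fin p), {z // WS p t (subInd k s) z}) → {z // WS p (t+1) k z} :=
  fun x => ⟨Fin.snoc (α := fun _ => Fin p → ℤ) x.2.1 k, by
    obtain ⟨s, z, h0, h1, h2, h3⟩ := x
    refine ⟨?_, ?_, ?_, ?_⟩
    · intro i
      have : (0 : Fin (t+1+1)) = Fin.castSucc 0 := rfl
      rw [this]
      simp [Fin.snoc_castSucc, h0, -Fin.castSucc_zero]
    · simp
    · intro u i
      induction u using Fin.lastCases with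
      | last =>
        rw [Fin.succ_last]
        simp only [Fin.snoc_last, Fin.snoc_castSucc, h1, subInd]
        split_ifs <;> simp
      | cast u =>
        rw [Fin.succ_castSucc]
        simp only [Fin.snoc_castSucc]
        exact h2 u i
    · intro u
      induction u using Fin.lastCases with
      | last => simpa using hk
      | cast u => simpa using h3 u⟩

lemma stepMap_bij (p t : ℕ) (k : Fin p → ℤ) (hk : Function.Injective k) :
    Function.Bijective (stepMap p t k hk) := by
  constructor
  · rintro ⟨s, z, hz⟩ ⟨s', z', hz'⟩ h
    simp only [stepMap, Subtype.mk.injEq] at h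
    have hzz : z = z' := by
      have := congrArg (Fin.init (α := fun _ => Fin p → ℤ)) h
      simpa using this
    subst hzz
    have : s = s' := subInd_inj k s s' (by rw [← hz.2.1, ← hz'.2.1])
    subst this
    rfl
  · rintro ⟨z, h0, h1, h2, h3⟩
    refine ⟨⟨Finset.univ.filter (fun i => z (Fin.last t).castSucc i = k i), 
      Fin.init (α := fun _ => Fin p → ℤ) z, ?_, ?_, ?_, ?_⟩, ?_⟩
    · intro i; exact h0 i
    · funext i
      have := h2 (Fin.last t) i
      rw [Fin.succ_last, h1] at this
      simp only [Fin.init, subInd, Finset.mem_filter, Finset.mem_univ, true_and]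
      split_ifs with h
      · exact h
      · rcases this with h' | h'
        · exact absurd h'.symm h
        · omega
    · intro u i
      have := h2 u.castSucc i
      rw [Fin.succ_castSucc] at this
      exact this
    · intro u; exact h3 _
    · apply Subtype.ext
      subst h1
      exact Fin.snoc_init_self z

lemma ws_empty (p t : ℕ) (k : Fin p → ℤ) (hk : ¬ Function.Injective k) :
    IsEmpty {z // WS p t k z} := by
  constructor
  rintro ⟨z, h0, h1, h2, h3⟩
  exact hk (h1 ▸ h3 _)

lemma ws_finite (p t : ℕ) : ∀ (k : Fin p → ℤ), Finite {z // WS p t k z} := by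
  induction t with
  | zero =>
    intro k
    have : Subsingleton {z // WS p 0 k z} := by
      constructor
      rintro ⟨z, h0, h1, h2, h3⟩ ⟨z', h0', h1', h2', h3'⟩
      congr 1
      funext s
      rw [show s = Fin.last 0 from Fin.ext (by have := s.2; simp at this ⊢), h1, h1']
    infer_instance
  | succ t ih =>
    intro k
    by_cases hk : Function.Injective k
    · exact Finite.of_surjective _ (stepMap_bij p t k hk).2
    · have := ws_empty p (t+1) k hk
      infer_instance

lemma ws_card_succ (p t : ℕ) (k : Fin p → ℤ) (hk : Function.Injective k) :
    Nat.card {z // WS p (t+1) k z} = ∑ s : Finset (Fin p), Nat.card {z // WS p t (subInd k s) z} := by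
  have := ws_finite p t
  rw [← Nat.card_eq_of_bijective _ (stepMap_bij p t k hk), Nat.card_sigma]

lemma ichoose_succ (a : ℕ) (k : ℤ) : ichoose (a+1) k = ichoose a k + ichoose a (k-1) := by
  unfold ichoose
  rcases lt_trichotomy k 0 with h | h | h
  · rw [if_neg (by omega), if_neg (by omega), if_neg (by omega)]
  · subst h; simp
  · obtain ⟨m, rfl⟩ : ∃ m : ℕ, k = m + 1 := ⟨(k-1).toNat, by omega⟩
    rw [if_pos (by omega), if_pos (by omega), if_pos (by omega)]
    have h1 : ((m:ℤ)+1).toNat = m + 1 := by omega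
    have h2 : ((m:ℤ)+1-1).toNat = m := by omega
    rw [h1, h2, Nat.choose_succ_succ, add_comm]

noncomputable def FM (p t : ℕ) (k : Fin p → ℤ) : Matrix (Fin p) (Fin p) ℝ :=
  fun j i => (ichoose (t + i) (k j) : ℝ)

lemma FM_succ (p t : ℕ) (k : Fin p → ℤ) :
    (FM p (t+1) k).det = ∑ s : Finset (Fin p), (FM p t (subInd k s)).det := by
  have h : FM p (t+1) k = FM p t k + FM p t (fun j => k j - 1) := by
    funext j i
    show (ichoose (t + 1 + i) (k j) : ℝ) = ichoose (t + i) (k j) + ichoose (t+i) (k j - 1)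
    rw [show t + 1 + (i:ℕ) = (t + i) + 1 by ring, ichoose_succ]
    push_cast; rfl
  have h2 := (Matrix.detRowAlternating (n := Fin p) (R := ℝ)).toMultilinearMap.map_add_univ
    (FM p t k) (FM p t (fun j => k j - 1))
  rw [h]
  refine h2.trans (Finset.sum_congr rfl fun s _ => ?_)
  show Matrix.det _ = _
  congr 1
  funext j i
  simp only [Finset.piecewise, FM, subInd]
  split_ifs <;> rfl

lemma FM_noninj (p t : ℕ) (k : Fin p → ℤ) (hk : ¬ Function.Injective k) : (FM p t k).det = 0 := by
  simp only [Function.Injective, not_forall] at hk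
  obtain ⟨i, j, h, hij⟩ := hk
  refine Matrix.det_zero_of_row_eq hij ?_
  funext l
  simp [FM, h]

lemma strictMono_eq_id (p : ℕ) (k : Fin p → ℤ) (hk : StrictMono k) (h : ∀ j, 0 ≤ k j ∧ k j < p) :
    ∀ j, k j = (j : ℤ) := by
  have h1 : StrictMono (fun j => (⟨(k j).toNat, by have := h j; omega⟩ : Fin p)) := by
    intro a b hab
    have := hk hab
    have := h a
    have := h b
    simp only [Fin.mk_lt_mk]
    omega
  intro j
  have h2 : (fun j => (⟨(k j).toNat, by have := h j; omega⟩ : Fin p)) = id := by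
    have h3 := Finite.injective_iff_surjective.1 h1.injective
    have := Subsingleton.elim (h1.orderIsoOfSurjective _ h3) (OrderIso.refl (Fin p))
    funext j
    exact congrArg (fun e => e j) this
  have := congrFun h2 j
  have h4 := congrArg Fin.val this
  simp only [id] at h4
  have := h j
  omega

lemma base (p : ℕ) (k : Fin p → ℤ) (hk : StrictMono k) :
    (Nat.card {z // WS p 0 k z} : ℝ) = (FM p 0 k).det := by
  by_cases h : ∀ j, k j = (j : ℤ)
  · have h1 : Nat.card {z // WS p 0 k z} = 1 := by
      rw [Nat.card_eq_one_iff_unique]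
      constructor
      · constructor
        rintro ⟨z, h0, h1, h2, h3⟩ ⟨z', h0', h1', h2', h3'⟩
        congr 1
        funext s
        rw [show s = Fin.last 0 from Fin.ext (by have := s.2; simp at this ⊢), h1, h1']
      · exact ⟨⟨fun _ => k, h, rfl, fun s => s.elim0, fun _ => hk.injective⟩⟩
    rw [h1, Matrix.det_of_isUpperTriangular]
    · symm
      push_cast
      apply Finset.prod_eq_one
      intro i _
      simp [FM, h, ichoose]
    · intro i j hij
      simp only [id] at hij
      simp only [FM, h, ichoose]
      simp [Nat.choose_eq_zero_of_lt, hij]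
  · have h1 : IsEmpty {z // WS p 0 k z} := by
      constructor
      rintro ⟨z, h0, h1, h2, h3⟩
      apply h
      intro j
      rw [← h1]; exact h0 j
    rw [Nat.card_of_isEmpty]
    have h2 : ¬ ∀ j, 0 ≤ k j ∧ k j < p := fun h' => h (strictMono_eq_id p k hk h')
    push Not at h2
    obtain ⟨j, hj⟩ := h2
    rw [Matrix.det_eq_zero_of_row_eq_zero j]
    · simp
    · intro i
      simp only [FM, ichoose]
      split_ifs with h5
      · have := hj h5
        rw [Nat.choose_eq_zero_of_lt]
        · simp
        · have := i.2; omega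
      · simp

lemma lgv (p t : ℕ) : ∀ (k : Fin p → ℤ), Monotone k → 
    (Nat.card {z // WS p t k z} : ℝ) = (FM p t k).det := by
  induction t with
  | zero =>
    intro k hk
    by_cases h : Function.Injective k
    · exact base p k (hk.strictMono_of_injective h)
    · have := ws_empty p 0 k h
      rw [FM_noninj p 0 k h, Nat.card_of_isEmpty]; simp
  | succ t ih =>
    intro k hk
    by_cases h : Function.Injective k
    · rw [ws_card_succ p t k h, FM_succ]
      push_cast
      refine Finset.sum_congr rfl fun s _ => ih _ ?_
      intro a b hab
      rcases hab.eq_or_lt with rfl | hab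
      · rfl
      have := hk.strictMono_of_injective h hab
      simp only [subInd]
      split_ifs <;> omega
    · have := ws_empty p (t+1) k h
      rw [FM_noninj p _ k h, Nat.card_of_isEmpty]; simp

lemma melon_card (p n : ℕ) : Nat.card {y : Fin p → Fin (2*n+1) → ℤ // IsMelon p n y} =
    Nat.card {z // WS p (2*n) (fun i => (i:ℤ) + n) z} := by
  symm
  refine Nat.card_eq_of_bijective (fun z => ⟨fun i t => 2 * z.1 t i - (t : ℕ), ?_⟩) ⟨?_, ?_⟩
  · obtain ⟨z, h0, h1, h2, h3⟩ := z
    refine ⟨?_, ?_, ?_, ?_⟩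
    · intro i; simp [h0]
    · intro i; simp [h1]; ring
    · intro i t
      have := h2 t i
      simp only [Fin.val_succ, Fin.val_castSucc]
      push_cast
      omega
    · intro i j hij t h
      exact hij (h3 t (by simp only at h; omega))
  · rintro ⟨z, hz⟩ ⟨z', hz'⟩ h
    apply Subtype.ext
    funext t i
    have := congrFun (congrFun (congrArg Subtype.val h) i) t
    simp only at this ⊢
    omega
  · rintro ⟨y, h0, h1, h2, h3⟩
    have par : ∀ i (t : Fin (2*n+1)), (y i t + (t:ℕ)) % 2 = 0 := by
      intro i t
      induction t using Fin.induction with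
      | zero => simp [h0]
      | succ t ih =>
        have := h2 i t
        simp only [Fin.val_succ, Fin.val_castSucc] at ih ⊢
        push_cast
        omega
    refine ⟨⟨fun t i => (y i t + (t:ℕ)) / 2, ?_, ?_, ?_, ?_⟩, ?_⟩
    · intro i; simp [h0]
    · funext i; simp [h1]; omega
    · intro t i
      have := h2 i t
      have a := par i t.castSucc
      have b := par i t.succ
      simp only [Fin.val_succ, Fin.val_castSucc] at a b ⊢
      push_cast at b ⊢
      omega
    · intro t i j h
      by_contra hij
      have := h3 i j hij t
      have a := par i t
      have b := par j t
      simp only at h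
      omega
    · apply Subtype.ext
      funext i t
      have a := par i t
      simp only
      omega

lemma entry_eq (q n i j : ℕ) (hi : i ≤ q) (hj : j ≤ q) :
    (2*n+i).choose (j+n) * ((n+j).factorial * (n+(q-j)).factorial) =
      (2*n+i).factorial * (n+(q-j)).descFactorial (q-i) := by
  by_cases h : j ≤ n + i
  · have h1 := Nat.choose_mul_factorial_mul_factorial (show n + j ≤ 2*n+i by omega)
    have h2 := Nat.factorial_mul_descFactorial (show q - i ≤ n + (q-j) by omega)
    rw [show n + (q-j) - (q-i) = 2*n+i-(n+j) by omega] at h2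
    rw [← h1, ← h2, add_comm j n]
    ring
  · rw [Nat.choose_eq_zero_of_lt (by omega), Nat.descFactorial_of_lt (by omega)]
    simp

lemma det_desc (q n : ℕ) : 
    (Matrix.of fun j i : Fin (q+1) => ((n+j : ℕ).descFactorial (i:ℕ) : ℝ)).det =
      ∏ i ∈ Finset.range (q+1), (i.factorial : ℝ) := by
  have h := Matrix.det_eval_matrixOfPolynomials_eq_det_vandermonde
    (fun j : Fin (q+1) => ((n + j : ℕ) : ℝ)) (fun i => descPochhammer ℝ (i:ℕ))
    (fun i => descPochhammer_natDegree ℝ i) (fun i => monic_descPochhammer ℝ i)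
  simp only [descPochhammer_eval_eq_descFactorial] at h
  rw [← h]
  have h2 := Matrix.det_vandermonde_id_eq_superFactorial (R := ℝ) q
  have h3 := Matrix.det_vandermonde_add (fun j : Fin (q+1) => ((j:ℕ) : ℝ)) (n : ℝ)
  rw [h2] at h3
  rw [← Nat.cast_prod, Nat.prod_range_succ_factorial, ← h3]
  congr 2
  funext j
  push_cast; ring

lemma det_eval (q n : ℕ) :
    (FM (q+1) (2*n) (fun i => (i:ℤ) + n)).det =
      ∏ i ∈ Finset.range (q+1), (((2*n+i).factorial : ℝ) / ((n+i).factorial : ℝ)^2 * (i.factorial : ℝ)) := by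
  have h : FM (q+1) (2*n) (fun i => (i:ℤ) + n) = 
      Matrix.of fun j i : Fin (q+1) => (((n+j : ℕ).factorial : ℝ) * ((n+(q-j):ℕ).factorial : ℝ))⁻¹ *
        (Matrix.of fun j i : Fin (q+1) => ((2*n+i : ℕ).factorial : ℝ) *
          (Matrix.of fun j i : Fin (q+1) => (((n+(q-j) : ℕ).descFactorial (q-i) : ℕ) : ℝ)) j i) j i := by
    funext j i
    have := entry_eq q n i j (by omega) (by omega)
    have h2 : ((j:ℤ)+n).toNat = j + n := by omega
    simp only [FM, ichoose, Matrix.of_apply]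
    rw [if_pos (by omega), h2, ← Nat.cast_mul, ← Nat.cast_mul, ← this]
    push_cast
    have a := Nat.cast_ne_zero (R := ℝ).2 (Nat.factorial_ne_zero (n+j))
    have b := Nat.cast_ne_zero (R := ℝ).2 (Nat.factorial_ne_zero (n+(q-j)))
    field_simp
  rw [h, Matrix.det_mul_column, Matrix.det_mul_row]
  have h4 : (Matrix.of fun j i : Fin (q+1) => (((n+(q-j) : ℕ).descFactorial (q-i) : ℕ) : ℝ)).det =
     ∏ i ∈ Finset.range (q+1), (i.factorial : ℝ) := by
    rw [← det_desc q n, ← Matrix.det_submatrix_equiv_self Fin.revPerm]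
    congr 1
    funext j i
    simp only [Matrix.submatrix_apply, Matrix.of_apply, Fin.revPerm_apply, Fin.val_rev]
    rw [show q - (q + 1 - ((j:ℕ) + 1)) = j by omega, show q - (q + 1 - ((i:ℕ) + 1)) = i by omega]
  rw [h4]
  have h5 : ∏ j : Fin (q+1), ((n+(q-j):ℕ).factorial : ℝ) = ∏ i ∈ Finset.range (q+1), ((n+i).factorial : ℝ) := by
    rw [Fin.prod_univ_eq_prod_range (fun j => ((n+(q-j):ℕ).factorial : ℝ)) (q+1)]
    rw [← Finset.prod_range_reflect]
    refine Finset.prod_congr rfl fun i hi => ?_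
    rw [Finset.mem_range] at hi
    rw [show q - (q + 1 - 1 - i) = i by omega]
  rw [Finset.prod_inv_distrib, Finset.prod_mul_distrib, h5,
    Fin.prod_univ_eq_prod_range (fun j => ((n+j:ℕ).factorial : ℝ)) (q+1),
    Fin.prod_univ_eq_prod_range (fun j => ((2*n+j:ℕ).factorial : ℝ)) (q+1),
    Finset.prod_mul_distrib, Finset.prod_div_distrib, Finset.prod_pow]
  rw [div_eq_mul_inv, sq]
  ring

noncomputable def rr (l n : ℕ) : ℝ := (2*n+l+1)/((n:ℝ)+l+1)^2 * (n/2)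

lemma fact_ratio (n i : ℕ) (hn : 0 < n) :
    ((2*n+i).factorial : ℝ) / ((n+i).factorial : ℝ)^2 =
      ((2*n).choose n : ℝ) * ((2/(n:ℝ))^i * ∏ l ∈ Finset.range i, rr l n) := by
  have hn' : (n:ℝ) ≠ 0 := by positivity
  induction i with
  | zero =>
    have := Nat.choose_mul_factorial_mul_factorial (show n ≤ 2*n by omega)
    rw [show 2*n-n = n by omega] at this
    have hf := Nat.cast_ne_zero (R := ℝ).2 (Nat.factorial_ne_zero n)
    simp only [add_zero, pow_zero, Finset.range_zero, Finset.prod_empty, mul_one]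
    rw [← this]
    push_cast
    field_simp
  | succ i ih =>
    rw [Finset.prod_range_succ, pow_succ (2/(n:ℝ))]
    have e1 : ((2:ℝ)/n)^i * (2/n) * ((∏ l ∈ Finset.range i, rr l n) * rr i n) =
      ((2:ℝ)/n)^i * (∏ l ∈ Finset.range i, rr l n) * ((2*n+i+1)/((n:ℝ)+i+1)^2) := by
      rw [show rr i n = (2*n+i+1)/((n:ℝ)+i+1)^2 * (n/2) from rfl]
      field_simp
    rw [e1, ← mul_assoc, ← ih, ← add_assoc, ← add_assoc, Nat.factorial_succ, Nat.factorial_succ]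
    have hf := Nat.cast_ne_zero (R := ℝ).2 (Nat.factorial_ne_zero (n+i))
    have h2 : (n:ℝ)+i+1 ≠ 0 := by positivity
    push_cast
    field_simp

lemma prod_bigO {ι : Type*} (s : Finset ι) (f : ι → ℕ → ℝ) 
    (h : ∀ i ∈ s, (fun n => f i n - 1) =O[atTop] (fun n : ℕ => (n : ℝ)⁻¹)) :
    (fun n => ∏ i ∈ s, f i n - 1) =O[atTop] (fun n : ℕ => (n : ℝ)⁻¹) := by
  classical
  induction s using Finset.induction_on with
  | empty => simpa using Asymptotics.isBigO_zero _ _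
  | insert a s ha ih =>
    have h1 := h a (Finset.mem_insert_self _ _)
    have h2 := ih fun i hi => h i (Finset.mem_insert_of_mem hi)
    have hb : (fun n : ℕ => (n : ℝ)⁻¹) =O[atTop] (fun _ : ℕ => (1 : ℝ)) :=
      (tendsto_inv_atTop_nhds_zero_nat (𝕜 := ℝ)).isBigO_one ℝ
    have h3 := h1.mul (h2.trans hb)
    simp only [mul_one] at h3
    refine ((h3.add h1).add h2).congr_left fun n => ?_
    rw [Finset.prod_insert ha]
    ring

lemma rr_bigO (l : ℕ) : (fun n => rr l n - 1) =O[atTop] (fun n : ℕ => (n : ℝ)⁻¹) := by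
  refine Asymptotics.IsBigO.of_bound (2*(l+1)) ?_
  filter_upwards [eventually_gt_atTop 0] with n hn
  have hn' : (0:ℝ) < n := by exact_mod_cast hn
  have hl : (0:ℝ) ≤ l := by positivity
  have e : rr l n - 1 = - ((3*n*(l+1) + 2*(l+1)^2) / (2*((n:ℝ)+l+1)^2)) := by
    unfold rr
    have : (n:ℝ)+l+1 ≠ 0 := by positivity
    field_simp
    ring
  rw [e, norm_neg, Real.norm_of_nonneg (by positivity), Real.norm_of_nonneg (by positivity),
    ← div_eq_mul_inv, div_le_div_iff₀ (by positivity) hn']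
  have key : 2*((l:ℝ)+1) * (2*((n:ℝ)+l+1)^2) - (3*n*(l+1) + 2*(l+1)^2) * n =
      (l+1)*n^2 + 6*(l+1)^2*n + 4*(l+1)^3 := by ring
  have : 0 ≤ ((l:ℝ)+1)*n^2 + 6*(l+1)^2*n + 4*(l+1)^3 := by positivity
  linarith

lemma prod_pow_choose (x : ℝ) (p : ℕ) : ∏ i ∈ Finset.range p, x^i = x^(p.choose 2) := by
  rw [Finset.prod_pow_eq_pow_sum, Finset.sum_range_id, Nat.choose_two_right]

/-- `m_n^{(p)} = (2/n)^{C(p,2)} · C(2n,n)^p · (Π_{i<p} i!) · (1 + O(1/n))` as `n → ∞`. -/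
theorem stmt4 (p : ℕ) (hp : 0 < p) :
    ∃ e : ℕ → ℝ, e =O[atTop] (fun n : ℕ => (n : ℝ)⁻¹) ∧
      ∀ᶠ n : ℕ in atTop,
        (Nat.card {y : Fin p → Fin (2*n+1) → ℤ // IsMelon p n y} : ℝ) =
          (2/(n : ℝ))^(p.choose 2) * (((2*n).choose n : ℝ))^p *
            (∏ i ∈ Finset.range p, (i.factorial : ℝ)) * (1 + e n) := by
  obtain ⟨q, rfl⟩ : ∃ q, p = q + 1 := ⟨p - 1, by omega⟩
  refine ⟨fun n => ∏ i ∈ Finset.range (q+1), (∏ l ∈ Finset.range i, rr l n) - 1,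
    prod_bigO _ _ fun i _ => prod_bigO _ _ fun l _ => rr_bigO l, ?_⟩
  filter_upwards [eventually_gt_atTop 0] with n hn
  rw [melon_card, lgv, det_eval]
  · rw [Finset.prod_congr rfl fun i _ => by rw [fact_ratio n i hn]]
    simp only [Finset.prod_mul_distrib]
    rw [prod_pow_choose, Finset.prod_const, Finset.card_range]
    ring
  · intro a b hab
    have : (a:ℕ) ≤ b := hab
    simp only
    omega
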